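/- Let (G,K) be a symmetric pair of compact type, with decomposition of the root system Δ_g = Δ' ∪ Δ'', where Δ'' consists of roots whose root spaces lie in p^ℂ. Then the root system of k with respect to t_k is exactly the set of restrictions {α|_{t_k} : α ∈ Δ'}. -/

import Mathlib

open scoped TensorProduct

/-- The complexification `g^ℂ = ℂ ⊗_ℝ g` of a real Lie algebra. -/
abbrev Complexification (g : Type*) [LieRing g] [LieAlgebra ℝ g] := ℂ ⊗[ℝ] g

/-- The root space of a linear functional `α` (its values on `t` being the relevant ones)
inside the complexification:
`g_α = {X ∈ g^ℂ | [W, X] = i·α(W)·X for all W ∈ t}`. -/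
def InRootSpace {g : Type*} [LieRing g] [LieAlgebra ℝ g]
    (t : Submodule ℝ g) (α : g →ₗ[ℝ] ℝ) (X : Complexification g) : Prop :=
  ∀ W ∈ t, ⁅(1 : ℂ) ⊗ₜ[ℝ] W, X⁆ = (Complex.I * (α W : ℂ)) • X

/-- `α` is a root of `g` with respect to the maximal abelian subalgebra `t_G`. -/
def IsRootOf {g : Type*} [LieRing g] [LieAlgebra ℝ g]
    (tG : Submodule ℝ g) (α : g →ₗ[ℝ] ℝ) : Prop :=
  (∃ W ∈ tG, α W ≠ 0) ∧ ∃ X : Complexification g, X ≠ 0 ∧ InRootSpace tG α X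

/-- A root `α ∈ Δ_g` belongs to `Δ' = {α ∈ Δ_g : g_α ⊄ p^ℂ}`, where `p` is the
`(-1)`-eigenspace of the involution `σ`: some nonzero element of the root space is not
anti-fixed by the complexified involution. -/
def InDeltaPrime {g : Type*} [LieRing g] [LieAlgebra ℝ g]
    (σ : g →ₗ⁅ℝ⁆ g) (tG : Submodule ℝ g) (α : g →ₗ[ℝ] ℝ) : Prop :=
  IsRootOf tG α ∧ ∃ X : Complexification g, X ≠ 0 ∧ InRootSpace tG α X ∧
    (σ.toLinearMap.baseChange ℂ) X ≠ -X

/-- `β` is a root of `k = g^σ` with respect to its maximal abelian subalgebra `t_k`: `β` is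
nonzero on `t_k` and the root space of `β` in `k^ℂ ⊆ g^ℂ` is nonzero. -/
def IsKRootOf {g : Type*} [LieRing g] [LieAlgebra ℝ g]
    (σ : g →ₗ⁅ℝ⁆ g) (tk : Submodule ℝ g) (β : g →ₗ[ℝ] ℝ) : Prop :=
  (∃ W ∈ tk, β W ≠ 0) ∧ ∃ Y : Complexification g, Y ≠ 0 ∧
    (σ.toLinearMap.baseChange ℂ) Y = Y ∧ InRootSpace tk β Y

namespace Complexification

variable {g : Type*} [LieRing g] [LieAlgebra ℝ g]

/-- The real part of an element of the complexification. -/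
noncomputable def re : Complexification g →ₗ[ℝ] g :=
  (TensorProduct.lid ℝ g).toLinearMap ∘ₗ Complex.reLm.rTensor g

/-- The imaginary part of an element of the complexification. -/
noncomputable def im : Complexification g →ₗ[ℝ] g :=
  (TensorProduct.lid ℝ g).toLinearMap ∘ₗ Complex.imLm.rTensor g

@[simp] lemma re_tmul (z : ℂ) (x : g) : re (z ⊗ₜ[ℝ] x) = z.re • x := by simp [re]

@[simp] lemma im_tmul (z : ℂ) (x : g) : im (z ⊗ₜ[ℝ] x) = z.im • x := by simp [im]

lemma tmul_re_add_tmul_im (X : Complexification g) :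
    (1 : ℂ) ⊗ₜ[ℝ] re X + Complex.I ⊗ₜ[ℝ] im X = X := by
  induction X using TensorProduct.induction_on with
  | zero => simp
  | tmul z x =>
    rw [re_tmul, im_tmul, ← TensorProduct.smul_tmul, ← TensorProduct.smul_tmul,
      ← TensorProduct.add_tmul]
    congr 1
    apply Complex.ext <;> simp
  | add X Y hX hY =>
    conv_rhs => rw [← hX, ← hY]
    simp only [map_add, TensorProduct.tmul_add]
    abel

/-- The action of `W ∈ g` on the complexification, as a complex linear endomorphism. -/
noncomputable def adjoint (W : g) : Module.End ℂ (Complexification g) :=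
  LieAlgebra.ad ℂ (Complexification g) ((1 : ℂ) ⊗ₜ[ℝ] W)

lemma lie_eq_adjoint (W : g) (X : Complexification g) :
    ⁅(1 : ℂ) ⊗ₜ[ℝ] W, X⁆ = adjoint W X := rfl

@[simp] lemma adjoint_tmul (W : g) (z : ℂ) (x : g) :
    adjoint W (z ⊗ₜ[ℝ] x) = z ⊗ₜ[ℝ] ⁅W, x⁆ := by
  rw [← lie_eq_adjoint, LieAlgebra.ExtendScalars.bracket_tmul, one_mul]

lemma adjoint_add (W W' : g) : adjoint (W + W') = adjoint W + adjoint W' := by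
  rw [adjoint, TensorProduct.tmul_add, map_add]; rfl

lemma adjoint_smul (c : ℝ) (W : g) : adjoint (c • W) = (c : ℂ) • adjoint W := by
  rw [adjoint, adjoint, ← map_smul]
  congr 1
  rw [TensorProduct.tmul_smul, TensorProduct.smul_tmul', TensorProduct.smul_tmul']
  simp

lemma adjoint_comm {W H : g} (h : ⁅W, H⁆ = 0) (X : Complexification g) :
    adjoint W (adjoint H X) = adjoint H (adjoint W X) := by
  induction X using TensorProduct.induction_on with
  | zero => simp
  | tmul z x => rw [adjoint_tmul, adjoint_tmul, adjoint_tmul, adjoint_tmul, leibniz_lie, h,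
      zero_lie, zero_add]
  | add X Y hX hY => simp only [map_add, hX, hY]

lemma re_adjoint (W : g) (X : Complexification g) : re (adjoint W X) = ⁅W, re X⁆ := by
  induction X using TensorProduct.induction_on with
  | zero => simp
  | tmul z x => simp
  | add X Y hX hY => rw [map_add, map_add, map_add, lie_add, hX, hY]

lemma im_adjoint (W : g) (X : Complexification g) : im (adjoint W X) = ⁅W, im X⁆ := by
  induction X using TensorProduct.induction_on with
  | zero => simp
  | tmul z x => simp
  | add X Y hX hY => rw [map_add, map_add, map_add, lie_add, hX, hY]

lemma re_I_smul (X : Complexification g) : re (Complex.I • X) = -im X := by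
  induction X using TensorProduct.induction_on with
  | zero => simp
  | tmul z x => simp [TensorProduct.smul_tmul']
  | add X Y hX hY => simp only [smul_add, map_add, hX, hY, neg_add]

lemma im_I_smul (X : Complexification g) : im (Complex.I • X) = re X := by
  induction X using TensorProduct.induction_on with
  | zero => simp
  | tmul z x => simp [TensorProduct.smul_tmul']
  | add X Y hX hY => simp only [smul_add, map_add, hX, hY]

/-- The real bilinear form `(X, Y) ↦ -B(re X, re Y) - B(im X, im Y)` on the complexification,
where `B` is the Killing form. -/
noncomputable def realForm : Complexification g →ₗ[ℝ] Complexification g →ₗ[ℝ] ℝ :=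
  -(killingForm ℝ g).compl₁₂ re re - (killingForm ℝ g).compl₁₂ im im

lemma realForm_apply (X Y : Complexification g) :
    realForm X Y = -killingForm ℝ g (re X) (re Y) - killingForm ℝ g (im X) (im Y) := by
  simp [realForm]

lemma realForm_pos (hcompact : ∀ x : g, x ≠ 0 → killingForm ℝ g x x < 0)
    {X : Complexification g} (hX : X ≠ 0) : 0 < realForm X X := by
  have key : ∀ x : g, killingForm ℝ g x x ≤ 0 := fun x => by
    by_cases hx : x = 0
    · simp [hx]
    · exact (hcompact x hx).le
  rw [realForm_apply]
  by_cases h : re X = 0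
  · have h2 : im X ≠ 0 := fun h2 => hX (by rw [← tmul_re_add_tmul_im X, h, h2]; simp)
    linarith [key (re X), hcompact _ h2]
  · linarith [key (im X), hcompact _ h]

lemma killingForm_lie_left (W x y : g) :
    killingForm ℝ g ⁅W, x⁆ y = -killingForm ℝ g x ⁅W, y⁆ := by
  rw [← lie_skew, map_neg, LinearMap.neg_apply]
  exact congrArg _ (LieModule.traceForm_apply_lie_apply ℝ g g x W y)

lemma realForm_adjoint_left (W : g) (X Y : Complexification g) :
    realForm (adjoint W X) Y = -realForm X (adjoint W Y) := by
  simp only [realForm_apply, re_adjoint, im_adjoint, killingForm_lie_left]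
  ring

lemma realForm_I_smul_left (X Y : Complexification g) :
    realForm (Complex.I • X) Y = -realForm X (Complex.I • Y) := by
  simp only [realForm_apply, re_I_smul, im_I_smul, map_neg, LinearMap.neg_apply]
  ring

lemma realForm_comm (X Y : Complexification g) : realForm X Y = realForm Y X := by
  have h := LieModule.traceForm_comm ℝ g g
  simp only [realForm_apply, killingForm, h (re X), h (im X)]

end Complexification

section SkewOperators

variable {V : Type*} [AddCommGroup V] [Module ℂ V] {R : V →ₗ[ℝ] V →ₗ[ℝ] ℝ}

/-- Eigenvalues of a skew operator are purely imaginary. -/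
lemma re_eq_zero_of_skew (hpos : ∀ x, x ≠ 0 → 0 < R x x) (hsymm : ∀ x y, R x y = R y x)
    (hI : ∀ x y, R (Complex.I • x) y = -R x (Complex.I • y))
    {A : Module.End ℂ V} (hA : ∀ x y, R (A x) y = -R x (A y))
    {μ : ℂ} {x : V} (hx : x ≠ 0) (h : A x = μ • x) : μ.re = 0 := by
  have h1 : R (A x) x = 0 := by have := hA x x; rw [hsymm x] at this; linarith
  have h2 : R (Complex.I • x) x = 0 := by have := hI x x; rw [hsymm x] at this; linarith
  have h3 : A x = μ.re • x + μ.im • (Complex.I • x) := by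
    rw [h]
    nth_rw 1 [← Complex.re_add_im μ]
    rw [add_smul, mul_smul, Complex.coe_smul, Complex.coe_smul]
  rw [h3, map_add, map_smul, map_smul] at h1
  simp only [LinearMap.add_apply, LinearMap.smul_apply, smul_eq_mul, h2, mul_zero, add_zero] at h1
  exact (mul_eq_zero.1 h1).resolve_right (hpos x hx).ne'

lemma sub_apply_eq_zero_of_skew (hpos : ∀ x, x ≠ 0 → 0 < R x x) (hsymm : ∀ x y, R x y = R y x)
    (hI : ∀ x y, R (Complex.I • x) y = -R x (Complex.I • y))
    {A : Module.End ℂ V} (hA : ∀ x y, R (A x) y = -R x (A y))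
    {μ : ℂ} {x : V} (h : A (A x - μ • x) = μ • (A x - μ • x)) : A x = μ • x := by
  by_contra hne
  have hy : A x - μ • x ≠ 0 := sub_ne_zero.2 hne
  have hre := re_eq_zero_of_skew hpos hsymm hI hA hy h
  have hμ : ∀ z : V, μ • z = μ.im • (Complex.I • z) := fun z => by
    nth_rw 1 [← Complex.re_add_im μ]
    rw [hre, Complex.ofReal_zero, zero_add, mul_smul, Complex.coe_smul]
  have h2 : R (A x - μ • x) (A x - μ • x) =
      -R x (A (A x - μ • x) - μ • (A x - μ • x)) := by
    have key : ∀ y, R (A x - μ • x) y = -R x (A y - μ • y) := fun y => by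
      rw [map_sub R, LinearMap.sub_apply, hA, map_sub (R x), hμ, hμ, R.map_smul,
        (R x).map_smul, LinearMap.smul_apply, hI]
      simp only [smul_eq_mul]
      ring
    exact key _
  rw [h, sub_self, map_zero, neg_zero] at h2
  exact (hpos _ hy).ne' h2

lemma maxGenEigenspace_le_eigenspace_of_skew (hpos : ∀ x, x ≠ 0 → 0 < R x x)
    (hsymm : ∀ x y, R x y = R y x) (hI : ∀ x y, R (Complex.I • x) y = -R x (Complex.I • y))
    {A : Module.End ℂ V} (hA : ∀ x y, R (A x) y = -R x (A y)) (μ : ℂ) :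
    A.maxGenEigenspace μ ≤ A.eigenspace μ := by
  intro x hx
  obtain ⟨k, hk⟩ := (Module.End.mem_maxGenEigenspace A μ x).1 hx
  rw [Module.End.mem_eigenspace_iff]
  induction k generalizing x with
  | zero =>
    have : x = 0 := by simpa using hk
    simp [this]
  | succ k ih =>
    rw [pow_succ, Module.End.mul_apply] at hk
    have hy := ih ((Module.End.mem_maxGenEigenspace A μ _).2 ⟨k, hk⟩) hk
    simp only [LinearMap.sub_apply, LinearMap.smul_apply, Module.End.one_apply] at hy
    exact sub_apply_eq_zero_of_skew hpos hsymm hI hA hy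

/-- A finite-dimensional complex vector space with a commuting family of skew operators is
spanned by joint eigenvectors. -/
lemma iSup_iInf_eigenspace_eq_top_of_skew [Module.Finite ℂ V] (hpos : ∀ x, x ≠ 0 → 0 < R x x)
    (hsymm : ∀ x y, R x y = R y x) (hI : ∀ x y, R (Complex.I • x) y = -R x (Complex.I • y))
    {ι : Type*} {A : ι → Module.End ℂ V} (hA : ∀ i x y, R (A i x) y = -R x (A i y))
    (hcomm : ∀ i j, Commute (A i) (A j)) :
    ⨆ χ : ι → ℂ, ⨅ i, (A i).eigenspace (χ i) = ⊤ := by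
  refine top_le_iff.1 ?_
  rw [← Module.End.iSup_iInf_maxGenEigenspace_eq_top_of_iSup_maxGenEigenspace_eq_top_of_commute A
    (fun i j _ => hcomm i j) fun i => Module.End.iSup_maxGenEigenspace_eq_top (A i)]
  exact iSup_mono fun χ => iInf_mono fun i =>
    maxGenEigenspace_le_eigenspace_of_skew hpos hsymm hI (hA i) (χ i)

end SkewOperators

section SymmetricPair

open Complexification

variable {g : Type*} [LieRing g] [LieAlgebra ℝ g]

/-- The centralizer of `tk` in `g` is abelian. -/
lemma lie_eq_zero_of_centralizes (hcompact : ∀ x : g, x ≠ 0 → killingForm ℝ g x x < 0)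
    {σ : g →ₗ⁅ℝ⁆ g} (hσinv : ∀ x, σ (σ x) = x) {tk : Submodule ℝ g}
    (htk_fixed : ∀ x ∈ tk, σ x = x)
    (htk_max : ∀ z : g, σ z = z → (∀ x ∈ tk, ⁅z, x⁆ = 0) → z ∈ tk)
    {z w : g} (hz : ∀ x ∈ tk, ⁅z, x⁆ = 0) (hw : ∀ x ∈ tk, ⁅w, x⁆ = 0) : ⁅z, w⁆ = 0 := by
  have hσ : ∀ {z : g}, (∀ x ∈ tk, ⁅z, x⁆ = 0) → ∀ x ∈ tk, ⁅σ z, x⁆ = 0 := fun {z} hz x hx => by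
    rw [← htk_fixed x hx, ← LieHom.map_lie, hz x hx, map_zero]
  have hadd : ∀ {z : g}, (∀ x ∈ tk, ⁅z, x⁆ = 0) → z + σ z ∈ tk := fun {z} hz =>
    htk_max _ (by rw [map_add, hσinv, add_comm]) fun x hx => by
      rw [add_lie, hz x hx, hσ hz x hx, add_zero]
  have hsub : ∀ {z : g}, (∀ x ∈ tk, ⁅z, x⁆ = 0) → ∀ x ∈ tk, ⁅z - σ z, x⁆ = 0 :=
    fun {z} hz x hx => by rw [sub_lie, hz x hx, hσ hz x hx, sub_zero]
  have hmem : ⁅z - σ z, w - σ w⁆ ∈ tk := by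
    refine htk_max _ ?_ fun x hx => ?_
    · rw [LieHom.map_lie, map_sub, map_sub, hσinv, hσinv, ← neg_sub z, ← neg_sub w, neg_lie,
        lie_neg, neg_neg]
    · rw [lie_lie, hsub hz x hx, hsub hw x hx, lie_zero, lie_zero, sub_zero]
  have hpp : ⁅z - σ z, w - σ w⁆ = 0 := by
    by_contra hne
    refine (hcompact _ hne).ne ?_
    rw [killingForm, LieModule.traceForm_apply_lie_apply, hsub hw _ hmem, map_zero]
  have hz0 : ⁅z + σ z, w⁆ = 0 := by rw [← lie_skew, hw _ (hadd hz), neg_zero]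
  have hw0 : ⁅z - σ z, w⁆ + ⁅z - σ z, w⁆ = 0 := by
    rw [← lie_add, show w + w = (w - σ w) + (w + σ w) by abel, lie_add, hpp,
      hsub hz _ (hadd hw), add_zero]
  have hw1 : ⁅z - σ z, w⁆ = 0 := by rwa [← two_smul ℝ, smul_eq_zero_iff_right two_ne_zero] at hw0
  have h2 : (2 : ℝ) • ⁅z, w⁆ = 0 := by
    rw [two_smul, ← add_lie, show z + z = (z + σ z) + (z - σ z) by abel, add_lie, hz0, hw1,
      add_zero]
  exact (smul_eq_zero_iff_right two_ne_zero).1 h2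

/-- `tG` is the centralizer of `tk` in `g`. -/
lemma mem_tG_iff_centralizes (hcompact : ∀ x : g, x ≠ 0 → killingForm ℝ g x x < 0)
    {σ : g →ₗ⁅ℝ⁆ g} (hσinv : ∀ x, σ (σ x) = x) {tk tG : Submodule ℝ g}
    (htk_fixed : ∀ x ∈ tk, σ x = x)
    (htk_max : ∀ z : g, σ z = z → (∀ x ∈ tk, ⁅z, x⁆ = 0) → z ∈ tk)
    (htksub : tk ≤ tG) (htG_abelian : ∀ x ∈ tG, ∀ y ∈ tG, ⁅x, y⁆ = 0)
    (htG_max : ∀ z : g, (∀ x ∈ tG, ⁅z, x⁆ = 0) → z ∈ tG) {z : g} :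
    z ∈ tG ↔ ∀ x ∈ tk, ⁅z, x⁆ = 0 :=
  ⟨fun hz x hx => htG_abelian z hz x (htksub hx), fun hz => htG_max z fun x hx =>
    lie_eq_zero_of_centralizes hcompact hσinv htk_fixed htk_max hz
      fun y hy => htG_abelian x hx y (htksub hy)⟩

lemma baseChange_adjoint (σ : g →ₗ⁅ℝ⁆ g) (W : g) (X : Complexification g) :
    (σ.toLinearMap.baseChange ℂ) (adjoint W X) =
      adjoint (σ W) ((σ.toLinearMap.baseChange ℂ) X) := by
  induction X using TensorProduct.induction_on with
  | zero => simp
  | tmul z x => simp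
  | add X Y hX hY => simp only [map_add, hX, hY]

lemma baseChange_involutive {σ : g →ₗ⁅ℝ⁆ g} (hσinv : ∀ x, σ (σ x) = x)
    (X : Complexification g) :
    (σ.toLinearMap.baseChange ℂ) ((σ.toLinearMap.baseChange ℂ) X) = X := by
  induction X using TensorProduct.induction_on with
  | zero => simp
  | tmul z x => simp [hσinv]
  | add X Y hX hY => simp only [map_add, hX, hY]

/-- The weight space of a linear functional as a complex subspace of the complexification. -/
def weightSubmodule (t : Submodule ℝ g) (α : g →ₗ[ℝ] ℝ) :
    Submodule ℂ (Complexification g) where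
  carrier := {X | InRootSpace t α X}
  zero_mem' := fun _ _ => by rw [lie_eq_adjoint, map_zero, smul_zero]
  add_mem' := fun {X Y} hX hY W hW => by
    rw [lie_eq_adjoint, map_add, ← lie_eq_adjoint, ← lie_eq_adjoint, hX W hW, hY W hW, smul_add]
  smul_mem' := fun c X hX W hW => by
    rw [lie_eq_adjoint, map_smul, ← lie_eq_adjoint, hX W hW, smul_comm]

lemma mem_weightSubmodule {t : Submodule ℝ g} {α : g →ₗ[ℝ] ℝ} {X : Complexification g} :
    X ∈ weightSubmodule t α ↔ InRootSpace t α X := Iff.rfl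

/-- A joint eigenvector of `t` with purely imaginary eigenvalues lies in a root space. -/
lemma exists_inRootSpace {t : Submodule ℝ g} {X : Complexification g} (hX : X ≠ 0) (χ : t → ℂ)
    (hχ : ∀ W : t, adjoint (W : g) X = χ W • X) (hre : ∀ W, (χ W).re = 0) :
    ∃ α : g →ₗ[ℝ] ℝ, InRootSpace t α X := by
  have hadd : ∀ W W', χ (W + W') = χ W + χ W' := fun W W' => by
    refine smul_left_injective ℂ hX ?_
    change χ (W + W') • X = (χ W + χ W') • X
    rw [add_smul, ← hχ, ← hχ, ← hχ, Submodule.coe_add, adjoint_add, LinearMap.add_apply]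
  have hsmul : ∀ (c : ℝ) W, χ (c • W) = c * χ W := fun c W => by
    refine smul_left_injective ℂ hX ?_
    change χ (c • W) • X = (c * χ W) • X
    rw [mul_smul, ← hχ, ← hχ, Submodule.coe_smul, adjoint_smul, LinearMap.smul_apply]
  obtain ⟨α, hα⟩ := LinearMap.exists_extend (p := t)
    { toFun := fun W => (χ W).im
      map_add' := fun W W' => by rw [hadd, Complex.add_im]
      map_smul' := fun c W => by simp [hsmul] }
  refine ⟨α, fun W hW => ?_⟩
  have hW' : α W = (χ ⟨W, hW⟩).im := LinearMap.congr_fun hα ⟨W, hW⟩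
  rw [lie_eq_adjoint, hχ ⟨W, hW⟩, hW']
  congr 1
  apply Complex.ext <;> simp [hre]

/-- If every root vector of `tG` of weight `β` on `tk` lies in a complex subspace `N`, then so
does the whole weight space of `β`. -/
lemma weightSubmodule_le_of_forall_inRootSpace [Module.Finite ℝ g]
    (hcompact : ∀ x : g, x ≠ 0 → killingForm ℝ g x x < 0) {tk tG : Submodule ℝ g}
    (htksub : tk ≤ tG) (htG_abelian : ∀ x ∈ tG, ∀ y ∈ tG, ⁅x, y⁆ = 0) (β : g →ₗ[ℝ] ℝ)
    (N : Submodule ℂ (Complexification g))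
    (hN : ∀ (α : g →ₗ[ℝ] ℝ) (X : Complexification g), X ≠ 0 → InRootSpace tG α X →
      (∀ H ∈ tk, β H = α H) → X ∈ N) :
    weightSubmodule tk β ≤ N := by
  set V := weightSubmodule tk β
  have hinv : ∀ W : tG, ∀ X ∈ V, adjoint (W : g) X ∈ V := by
    refine fun W X hX => mem_weightSubmodule.2 fun H hH => ?_
    rw [lie_eq_adjoint, adjoint_comm (htG_abelian H (htksub hH) W W.2), ← lie_eq_adjoint H,
      mem_weightSubmodule.1 hX H hH, map_smul]
  let A : tG → Module.End ℂ V := fun W => (adjoint (W : g)).restrict (hinv W)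
  let incl : V →ₗ[ℝ] Complexification g := V.subtype.restrictScalars ℝ
  let R : V →ₗ[ℝ] V →ₗ[ℝ] ℝ := realForm.compl₁₂ incl incl
  have hpos : ∀ x, x ≠ 0 → 0 < R x x := fun x hx =>
    realForm_pos hcompact (fun h => hx (Subtype.ext h))
  have hsymm : ∀ x y, R x y = R y x := fun x y => realForm_comm _ _
  have hI : ∀ x y, R (Complex.I • x) y = -R x (Complex.I • y) :=
    fun x y => realForm_I_smul_left _ _
  have hA : ∀ W x y, R (A W x) y = -R x (A W y) := fun W x y => realForm_adjoint_left _ _ _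
  have htop := iSup_iInf_eigenspace_eq_top_of_skew hpos hsymm hI hA fun W W' =>
    LinearMap.ext fun X => Subtype.ext (adjoint_comm (htG_abelian W W.2 W' W'.2) X)
  have hle : ⊤ ≤ N.comap V.subtype := by
    rw [← htop]
    refine iSup_le fun χ X hX => ?_
    by_cases hX0 : X = 0
    · rw [hX0]; exact zero_mem _
    have heig : ∀ W, A W X = χ W • X := fun W =>
      Module.End.mem_eigenspace_iff.1 ((Submodule.mem_iInf _).1 hX W)
    have hX0' : (X : Complexification g) ≠ 0 := fun h => hX0 (Subtype.ext h)
    obtain ⟨α, hα⟩ := exists_inRootSpace hX0' χ (fun W => congrArg Subtype.val (heig W))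
      fun W => re_eq_zero_of_skew hpos hsymm hI (hA W) hX0 (heig W)
    refine hN α X hX0' hα fun H hH => ?_
    have h := smul_left_injective ℂ hX0'
      ((mem_weightSubmodule.1 X.2 H hH).symm.trans (hα H (htksub hH)))
    exact_mod_cast mul_left_cancel₀ Complex.I_ne_zero h
  exact fun X hX => hle (x := ⟨X, hX⟩) trivial

end SymmetricPair

/-- Let `(g, k)` be the symmetric Lie algebra pair of a symmetric pair of compact type, with
involution `σ`, maximal abelian subalgebra `t_k ⊆ k = g^σ`, and maximal abelian subalgebra
`t_G ⊇ t_k` of `g`.  Then the root system of `k` with respect to `t_k` is exactly the set of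
restrictions to `t_k` of the roots in `Δ' = {α ∈ Δ_g : g_α ⊄ p^ℂ}`. -/
theorem k_roots_eq_restrictions_of_deltaPrime
    {g : Type*} [LieRing g] [LieAlgebra ℝ g] [Module.Finite ℝ g]
    (hcompact : ∀ x : g, x ≠ 0 → killingForm ℝ g x x < 0)
    (σ : g →ₗ⁅ℝ⁆ g) (hσinv : ∀ x, σ (σ x) = x)
    (tk tG : Submodule ℝ g)
    (htk_fixed : ∀ x ∈ tk, σ x = x)
    (htk_abelian : ∀ x ∈ tk, ∀ y ∈ tk, ⁅x, y⁆ = 0)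
    (htk_max : ∀ z : g, σ z = z → (∀ x ∈ tk, ⁅z, x⁆ = 0) → z ∈ tk)
    (htksub : tk ≤ tG)
    (htG_abelian : ∀ x ∈ tG, ∀ y ∈ tG, ⁅x, y⁆ = 0)
    (htG_max : ∀ z : g, (∀ x ∈ tG, ⁅z, x⁆ = 0) → z ∈ tG)
    (β : g →ₗ[ℝ] ℝ) :
    IsKRootOf σ tk β ↔
      ∃ α : g →ₗ[ℝ] ℝ, InDeltaPrime σ tG α ∧ ∀ H ∈ tk, β H = α H := by
  set S := σ.toLinearMap.baseChange ℂ with hS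
  constructor
  · rintro ⟨⟨H, hH, hβH⟩, Y, hY0, hSY, hY⟩
    by_contra! hno
    have hmem := weightSubmodule_le_of_forall_inRootSpace hcompact htksub htG_abelian β
      (LinearMap.ker (S + LinearMap.id)) (fun α X hX0 hX hα => by
        by_contra hXN
        obtain ⟨H', hH', hne⟩ := hno α
          ⟨⟨⟨H, htksub hH, hα H hH ▸ hβH⟩, X, hX0, hX⟩, X, hX0, hX, fun h => hXN (by
            rw [LinearMap.mem_ker, LinearMap.add_apply, LinearMap.id_apply]
            exact eq_neg_iff_add_eq_zero.1 h)⟩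
        exact hne (hα H' hH')) (mem_weightSubmodule.2 hY)
    rw [LinearMap.mem_ker, LinearMap.add_apply, LinearMap.id_apply, hSY, ← two_smul ℂ] at hmem
    exact hY0 ((smul_eq_zero.1 hmem).resolve_left two_ne_zero)
  · rintro ⟨α, ⟨⟨⟨W, hW, hαW⟩, -⟩, X, hX0, hX, hSX⟩, hβ⟩
    refine ⟨?_, X + S X, fun h => hSX (eq_neg_of_add_eq_zero_right h), ?_, ?_⟩
    · by_contra! hzero
      have hcent : ∀ H ∈ tk, Complexification.adjoint H X = 0 := fun H hH => by
        rw [← Complexification.lie_eq_adjoint, hX H (htksub hH), ← hβ H hH, hzero H hH]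
        simp
      have hmem := @mem_tG_iff_centralizes g _ _ hcompact σ hσinv tk tG htk_fixed htk_max htksub
        htG_abelian htG_max
      have hre : Complexification.re X ∈ tG := hmem.2 fun H hH => by
        rw [← lie_skew, ← Complexification.re_adjoint, hcent H hH, map_zero, neg_zero]
      have him : Complexification.im X ∈ tG := hmem.2 fun H hH => by
        rw [← lie_skew, ← Complexification.im_adjoint, hcent H hH, map_zero, neg_zero]
      have hWX : Complexification.adjoint W X = 0 := by
        rw [← Complexification.tmul_re_add_tmul_im (Complexification.adjoint W X),
          Complexification.re_adjoint,
          Complexification.im_adjoint, htG_abelian W hW _ hre, htG_abelian W hW _ him]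
        simp
      rw [← Complexification.lie_eq_adjoint, hX W hW] at hWX
      rcases smul_eq_zero.1 hWX with h | h
      · exact hαW (by simpa using h)
      · exact hX0 h
    · rw [← hS, map_add, baseChange_involutive hσinv, add_comm]
    · have h1 : InRootSpace tk β X := fun H hH => by rw [hX H (htksub hH), hβ H hH]
      have h2 : InRootSpace tk β (S X) := fun H hH => by
        have h := baseChange_adjoint σ H X
        rw [htk_fixed H hH] at h
        rw [Complexification.lie_eq_adjoint, hS, ← h, ← Complexification.lie_eq_adjoint,
          h1 H hH, map_smul]
      exact mem_weightSubmodule.1 (add_mem (mem_weightSubmodule.2 h1) (mem_weightSubmodule.2 h2))
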